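/- arXiv:1903.05895 — 3 statements merged into one kernel-verified Lean document; each statement's English description precedes it below -/
import Mathlib

section
/- Let m ≥ 1 and N = 2^m. For 1 ≤ s ≤ m, let B^{(s)} ∈ ℂ^{2^s×2^s} be the block matrix [[I, Ω_s],[I, −Ω_s]] where I is the 2^{s−1}×2^{s−1} identity and Ω_s is the diagonal matrix with entries exp(−2πi·j/2^s) for 0 ≤ j < 2^{s−1}. Let R ∈ ℂ^{N×N} be the bit-reversal permutation matrix, with R_{k,n} = 1 if n is the m-bit bit-reversal of k and 0 otherwise. Then the DFT matrix F_N with entries (F_N)_{k,n} = exp(−2πi·k·n/N) satisfies F_N = (∏_{k=0}^{m−1} (I_{2^k} ⊗ B^{(m−k)})) · R, where the product is taken left-to-right in increasing k and I_{2^k} ⊗ B^{(m−k)} denotes the Kronecker product (a block-diagonal matrix with 2^k copies of B^{(m−k)}), with indices identified with Fin N via the standard bijection Fin 2^k × Fin 2^{m−k} ≃ Fin 2^m. -/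
open Complex Kronecker

/-- The DFT matrix of size `n`, with entries `exp(−2πi·k·j/n)`. -/
noncomputable def dftMatrix (n : ℕ) : Matrix (Fin n) (Fin n) ℂ :=
  Matrix.of fun k j => Complex.exp (-2 * Real.pi * Complex.I * (k : ℕ) * (j : ℕ) / n)

/-- `bitRev m k` is the `m`-bit bit-reversal of `k`: if `k` has binary expansion
`b_{m−1}…b_1b_0` then `bitRev m k` has binary expansion `b_0b_1…b_{m−1}`. -/
def bitRev : ℕ → ℕ → ℕ
  | 0, _ => 0
  | m + 1, k => k % 2 * 2 ^ m + bitRev m (k / 2)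

lemma bitRev_lt (m k : ℕ) : bitRev m k < 2 ^ m := by
  induction m generalizing k with
  | zero => simp [bitRev]
  | succ m ih =>
    have h1 := ih (k / 2)
    have h2 : k % 2 < 2 := Nat.mod_lt _ (by norm_num)
    simp only [bitRev, pow_succ]
    nlinarith

/-- The bit-reversal permutation matrix on `Fin (2^m)`:
`R_{k,n} = 1` iff `n` is the `m`-bit bit-reversal of `k`. -/
def bitRevMatrix (m : ℕ) : Matrix (Fin (2 ^ m)) (Fin (2 ^ m)) ℂ :=
  Matrix.of fun k n => if (n : ℕ) = bitRev m (k : ℕ) then 1 else 0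

/-- The butterfly factor `B^{(s+1)}` of size `2·2^s = 2^{s+1}`: the block matrix
`[[I, Ω],[I, −Ω]]` where `Ω` is the diagonal matrix of twiddle factors
`exp(−2πi·j/2^{s+1})`, `0 ≤ j < 2^s`. -/
noncomputable def butterflyB (s : ℕ) : Matrix (Fin (2 * 2 ^ s)) (Fin (2 * 2 ^ s)) ℂ :=
  Matrix.reindex (finSumFinEquiv.trans (finCongr (two_mul (2 ^ s)).symm))
    (finSumFinEquiv.trans (finCongr (two_mul (2 ^ s)).symm))
    (Matrix.fromBlocks 1
      (Matrix.diagonal fun j : Fin (2 ^ s) =>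
        Complex.exp (-2 * Real.pi * Complex.I * (j : ℕ) / (2 * 2 ^ s)))
      1
      (-(Matrix.diagonal fun j : Fin (2 ^ s) =>
        Complex.exp (-2 * Real.pi * Complex.I * (j : ℕ) / (2 * 2 ^ s)))))

lemma pow_split {m k : ℕ} (hk : k < m) : 2 ^ k * (2 * 2 ^ (m - k - 1)) = 2 ^ m := by
  rw [← pow_succ' 2 (m - k - 1), ← pow_add]
  congr 1
  omega

/-- The standard identification `Fin (2^k) × Fin (2^{m−k}) ≃ Fin (2^m)` (row-major),
under which `I_{2^k} ⊗ B` becomes a block-diagonal matrix with `2^k` copies of `B`. -/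
def kronEquiv {m : ℕ} (k : Fin m) :
    Fin (2 ^ (k : ℕ)) × Fin (2 * 2 ^ (m - (k : ℕ) - 1)) ≃ Fin (2 ^ m) :=
  finProdFinEquiv.trans (finCongr (pow_split k.isLt))

/-- The entries of `butterflyB s` as a function of natural-number indices. -/
noncomputable def butterflyEntry (s i j : ℕ) : ℂ :=
  if i % 2 ^ s = j % 2 ^ s then
    if j < 2 ^ s then 1
    else if i < 2 ^ s then Complex.exp (-2 * Real.pi * Complex.I * (i % 2 ^ s : ℕ) / (2 * 2 ^ s))
    else -Complex.exp (-2 * Real.pi * Complex.I * (i % 2 ^ s : ℕ) / (2 * 2 ^ s))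
  else 0

lemma butterflyB_apply (s : ℕ) (i j : Fin (2 * 2 ^ s)) :
    butterflyB s i j = butterflyEntry s i j := by
  obtain ⟨i, rfl⟩ := (finSumFinEquiv.trans (finCongr (two_mul (2 ^ s)).symm)).surjective i
  obtain ⟨j, rfl⟩ := (finSumFinEquiv.trans (finCongr (two_mul (2 ^ s)).symm)).surjective j
  rw [butterflyB, Matrix.reindex_apply, Matrix.submatrix_apply, Equiv.symm_apply_apply,
    Equiv.symm_apply_apply]
  rcases i with i | i <;> rcases j with j | j <;>
    simp [butterflyEntry, Matrix.one_apply, Matrix.diagonal_apply, Nat.mod_eq_of_lt, Fin.ext_iff]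

/-- The factor `I_{2^k} ⊗ B^{(m−k)}`, indexed by `Fin (2^m)`. -/
noncomputable def butterflyFactor (m : ℕ) (k : Fin m) : Matrix (Fin (2 ^ m)) (Fin (2 ^ m)) ℂ :=
  Matrix.reindex (kronEquiv k) (kronEquiv k)
    ((1 : Matrix (Fin (2 ^ (k : ℕ))) (Fin (2 ^ (k : ℕ))) ℂ) ⊗ₖ butterflyB (m - (k : ℕ) - 1))

lemma butterflyFactor_apply (m : ℕ) (k : Fin m) (i j : Fin (2 ^ m)) :
    butterflyFactor m k i j =
      if (i : ℕ) / (2 * 2 ^ (m - (k : ℕ) - 1)) = j / (2 * 2 ^ (m - (k : ℕ) - 1)) then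
        butterflyEntry (m - (k : ℕ) - 1) (i % (2 * 2 ^ (m - (k : ℕ) - 1)))
          (j % (2 * 2 ^ (m - (k : ℕ) - 1)))
      else 0 := by
  simp [butterflyFactor, kronEquiv, butterflyB_apply, Matrix.one_apply, Fin.ext_iff,
    finProdFinEquiv, Fin.divNat, Fin.modNat]

/-- The row-major identification `Fin 2 × Fin (2^m) ≃ Fin (2^(m+1))`. -/
def halfEquiv (m : ℕ) : Fin 2 × Fin (2 ^ m) ≃ Fin (2 ^ (m + 1)) :=
  finProdFinEquiv.trans (finCongr (pow_succ' 2 m).symm)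

lemma halfEquiv_val (m : ℕ) (a : Fin 2) (b : Fin (2 ^ m)) :
    (halfEquiv m (a, b) : ℕ) = b + 2 ^ m * a := by
  simp [halfEquiv, finProdFinEquiv]

/-- The block-diagonal matrix `I_2 ⊗ A`, as a monoid homomorphism in `A`. -/
noncomputable def doubleHom (m : ℕ) :
    Matrix (Fin (2 ^ m)) (Fin (2 ^ m)) ℂ →* Matrix (Fin (2 ^ (m + 1))) (Fin (2 ^ (m + 1))) ℂ where
  toFun A := Matrix.reindex (halfEquiv m) (halfEquiv m) ((1 : Matrix (Fin 2) (Fin 2) ℂ) ⊗ₖ A)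
  map_one' := by simp
  map_mul' A B := by
    simp [← Matrix.mul_kronecker_mul, Matrix.submatrix_mul_equiv]

lemma doubleHom_apply (m : ℕ) (A : Matrix (Fin (2 ^ m)) (Fin (2 ^ m)) ℂ) (a c : Fin 2)
    (b d : Fin (2 ^ m)) :
    doubleHom m A (halfEquiv m (a, b)) (halfEquiv m (c, d)) = if a = c then A b d else 0 := by
  simp [doubleHom, Matrix.one_apply]

lemma butterflyFactor_succ (m : ℕ) (k : Fin m) :
    butterflyFactor (m + 1) k.succ = doubleHom m (butterflyFactor m k) := by
  ext i j
  obtain ⟨⟨a, b⟩, rfl⟩ := (halfEquiv m).surjective i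
  obtain ⟨⟨c, d⟩, rfl⟩ := (halfEquiv m).surjective j
  have hsub : m + 1 - ((k.succ : Fin (m + 1)) : ℕ) - 1 = m - k - 1 := by simp
  rw [doubleHom_apply, butterflyFactor_apply, butterflyFactor_apply, halfEquiv_val, halfEquiv_val,
    hsub]
  set q := 2 * 2 ^ (m - (k : ℕ) - 1)
  have hsplit : 2 ^ m = q * 2 ^ (k : ℕ) := by rw [← pow_split k.isLt, mul_comm]
  have hqpos : 0 < q := by positivity
  have hdiv (x y : ℕ) : (x + 2 ^ m * y) / q = x / q + 2 ^ (k : ℕ) * y := by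
    rw [hsplit, mul_assoc, Nat.add_mul_div_left _ _ hqpos]
  have hmod (x y : ℕ) : (x + 2 ^ m * y) % q = x % q := by
    rw [hsplit, mul_assoc, Nat.add_mul_mod_self_left]
  have hlt (x : Fin (2 ^ m)) : (x : ℕ) / q < 2 ^ (k : ℕ) := by
    rw [Nat.div_lt_iff_lt_mul hqpos, mul_comm, ← hsplit]
    exact x.isLt
  rw [hdiv, hdiv, hmod, hmod, ← ite_and]
  congr 1
  have hb := hlt b
  have hd := hlt d
  refine propext ⟨fun h => ?_, fun ⟨h₁, h₂⟩ => by rw [h₁, h₂]⟩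
  generalize (b : ℕ) / q = x at *
  generalize (d : ℕ) / q = y at *
  fin_cases a <;> fin_cases c <;> simp at h ⊢ <;> omega

lemma bitRev_add_two_pow_mul (m a b : ℕ) (ha : a < 2) (hb : b < 2 ^ m) :
    bitRev (m + 1) (b + 2 ^ m * a) = 2 * bitRev m b + a := by
  induction m generalizing b with
  | zero => simp_all [bitRev, Nat.mod_eq_of_lt]
  | succ m ih =>
    have hdiv : (b + 2 ^ (m + 1) * a) / 2 = b / 2 + 2 ^ m * a := by
      rw [pow_succ', mul_assoc, Nat.add_mul_div_left _ _ two_pos]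
    have hmod : (b + 2 ^ (m + 1) * a) % 2 = b % 2 := by
      rw [pow_succ', mul_assoc, Nat.add_mul_mod_self_left]
    rw [bitRev, hdiv, hmod, ih _ (by rw [pow_succ] at hb; omega), bitRev]
    ring

lemma half_lt_two_pow {m n : ℕ} (hn : n < 2 ^ (m + 1)) : n / 2 < 2 ^ m :=
  Nat.div_lt_of_lt_mul (by rwa [← pow_succ'])

lemma doubleHom_mul_bitRevMatrix_apply (m : ℕ) (A : Matrix (Fin (2 ^ m)) (Fin (2 ^ m)) ℂ)
    (a : Fin 2) (b : Fin (2 ^ m)) (n : Fin (2 ^ (m + 1))) :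
    (doubleHom m A * bitRevMatrix (m + 1)) (halfEquiv m (a, b)) n =
      if (n : ℕ) % 2 = a then
        (A * bitRevMatrix m) b ⟨n / 2, half_lt_two_pow n.isLt⟩
      else 0 := by
  rw [Matrix.mul_apply, ← (halfEquiv m).sum_comp, Fintype.sum_prod_type,
    Finset.sum_eq_single a (by
      intro c _ hc
      simp [doubleHom_apply, hc.symm]) (by simp), Matrix.mul_apply]
  simp only [doubleHom_apply, bitRevMatrix, Matrix.of_apply, halfEquiv_val, if_true]
  have hiff (x : Fin (2 ^ m)) : (n : ℕ) = bitRev (m + 1) (x + 2 ^ m * a) ↔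
      (n : ℕ) % 2 = a ∧ (n : ℕ) / 2 = bitRev m x := by
    rw [bitRev_add_two_pow_mul m a x a.isLt x.isLt]
    omega
  simp only [hiff]
  split_ifs with h <;> simp [h]

lemma butterflyFactor_zero_apply (m : ℕ) (a c : Fin 2) (b d : Fin (2 ^ m)) :
    butterflyFactor (m + 1) 0 (halfEquiv m (a, b)) (halfEquiv m (c, d)) =
      if b = d then
        if c = 0 then 1
        else (-1) ^ (a : ℕ) * Complex.exp (-2 * Real.pi * Complex.I * (b : ℕ) / (2 * 2 ^ m))
      else 0 := by
  have hlt (i : Fin (2 ^ (m + 1))) : (i : ℕ) < 2 * 2 ^ m := by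
    rw [← pow_succ']; exact i.isLt
  rw [butterflyFactor_apply]
  simp only [Fin.val_zero, Nat.sub_zero, Nat.add_sub_cancel]
  rw [Nat.div_eq_of_lt (hlt _), Nat.div_eq_of_lt (hlt _), Nat.mod_eq_of_lt (hlt _),
    Nat.mod_eq_of_lt (hlt _), if_pos rfl]
  simp only [halfEquiv_val, butterflyEntry, Nat.add_mul_mod_self_left,
    Nat.mod_eq_of_lt b.isLt, Nat.mod_eq_of_lt d.isLt, Fin.ext_iff]
  fin_cases a <;> fin_cases c <;> simp

lemma dftMatrix_succ (m : ℕ) (a : Fin 2) (b : Fin (2 ^ m)) (n : Fin (2 ^ (m + 1))) :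
    dftMatrix (2 ^ (m + 1)) (halfEquiv m (a, b)) n =
      (if (n : ℕ) % 2 = 0 then 1
        else (-1) ^ (a : ℕ) * Complex.exp (-2 * Real.pi * Complex.I * (b : ℕ) / (2 * 2 ^ m))) *
        dftMatrix (2 ^ m) b ⟨n / 2, half_lt_two_pow n.isLt⟩ := by
  have hexp (t : ℕ) : Complex.exp (-(2 * Real.pi * Complex.I * t)) = 1 := by
    rw [Complex.exp_eq_one_iff]
    exact ⟨-t, by push_cast; ring⟩
  have hpi (t : ℕ) : Complex.exp (-(Real.pi * Complex.I * t)) = (-1) ^ t := by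
    rw [← Complex.exp_neg_pi_mul_I, ← Complex.exp_nat_mul]
    ring_nf
  have hpow : (2 : ℂ) ^ m ≠ 0 := pow_ne_zero _ two_ne_zero
  simp only [dftMatrix, Matrix.of_apply, halfEquiv_val]
  obtain ⟨q, hq | hq⟩ := Nat.even_or_odd' (n : ℕ)
  · have hn : (n : ℕ) / 2 = q := by omega
    simp only [hn]
    rw [hq, if_pos (by omega), one_mul, ← one_mul (Complex.exp (_ / ((2 ^ m : ℕ) : ℂ))),
      ← hexp (a * q), ← Complex.exp_add]
    congr 1
    push_cast
    field_simp
    ring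
  · have hn : (n : ℕ) / 2 = q := by omega
    simp only [hn]
    rw [hq, if_neg (by omega), ← hpi, ← one_mul (Complex.exp (_ / ((2 ^ m : ℕ) : ℂ))),
      ← hexp (a * q), ← Complex.exp_add, ← Complex.exp_add, ← Complex.exp_add]
    congr 1
    push_cast
    field_simp
    ring

/-- One step of the Cooley–Tukey recursion. -/
lemma dftMatrix_succ_eq_mul (m : ℕ) (A : Matrix (Fin (2 ^ m)) (Fin (2 ^ m)) ℂ)
    (hA : dftMatrix (2 ^ m) = A * bitRevMatrix m) :
    dftMatrix (2 ^ (m + 1)) =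
      butterflyFactor (m + 1) 0 * (doubleHom m A * bitRevMatrix (m + 1)) := by
  ext i n
  obtain ⟨⟨a, b⟩, rfl⟩ := (halfEquiv m).surjective i
  rw [Matrix.mul_apply, ← (halfEquiv m).sum_comp, Fintype.sum_prod_type]
  simp only [doubleHom_mul_bitRevMatrix_apply, butterflyFactor_zero_apply, ← hA, ite_mul, zero_mul,
    Finset.sum_ite_eq, Finset.mem_univ, if_true, Fin.sum_univ_two]
  rw [dftMatrix_succ]
  rcases Nat.mod_two_eq_zero_or_one n with h | h <;> simp [h]

lemma dftMatrix_eq_prod_butterflyFactor_mul (m : ℕ) :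
    dftMatrix (2 ^ m) = (List.ofFn (butterflyFactor m)).prod * bitRevMatrix m := by
  induction m with
  | zero =>
    ext i j
    simp [dftMatrix, bitRevMatrix, bitRev]
  | succ m ih =>
    rw [dftMatrix_succ_eq_mul m _ ih, map_list_prod, List.map_ofFn, List.ofFn_succ, List.prod_cons,
      mul_assoc]
    simp only [butterflyFactor_succ, Function.comp_def]

/-- **Full butterfly factorization of the DFT (Cooley–Tukey FFT).**  For `N = 2^m`,
`F_N = (∏_{k=0}^{m−1} I_{2^k} ⊗ B^{(m−k)}) · R` where the product is taken left-to-right in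
increasing `k`, `B^{(m−k)} = butterflyB (m−k−1)` is the butterfly factor of size `2^{m−k}`,
`⊗` is the Kronecker product (indices identified with `Fin (2^m)` via the standard bijection),
and `R` is the bit-reversal permutation matrix. -/
theorem dft_eq_butterfly_mul_bitRev (m : ℕ) (hm : 1 ≤ m) :
    dftMatrix (2 ^ m) =
      (List.ofFn fun k : Fin m =>
        Matrix.reindex (kronEquiv k) (kronEquiv k)
          ((1 : Matrix (Fin (2 ^ (k : ℕ))) (Fin (2 ^ (k : ℕ))) ℂ) ⊗ₖ
            butterflyB (m - (k : ℕ) - 1))).prod * bitRevMatrix m := by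
  exact dftMatrix_eq_prod_butterflyFactor_mul m
end

section
/- Let m ≥ 1 and N = 2^m. For 2 ≤ s ≤ m, let P_{2^s} denote the even–odd separation permutation on Fin 2^s, sending position k to 2k for 0 ≤ k < 2^{s−1} and position 2^{s−1}+k to 2k+1 (i.e., on vectors, (P x)_k = x_{2k} and (P x)_{2^{s−1}+k} = x_{2k+1}). Then the composition of permutations of Fin N given by (I_{2^{m−2}} blocks of P_4) ∘ ⋯ ∘ (I_2 blocks of P_{2^{m−1}}) ∘ P_{2^m}, where the factor at stage s (s = m, m−1, …, 2, applied in that order to the input) acts as P_{2^s} independently on each of the 2^{m−s} consecutive blocks of length 2^s, equals the m-bit bit-reversal permutation of Fin N. -/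
/-- The `m`-bit bit-reversal permutation of `Fin (2^m)`. -/
def bitRevFun (m : ℕ) : Fin (2 ^ m) → Fin (2 ^ m) :=
  fun k => ⟨bitRev m (k : ℕ), bitRev_lt m _⟩

/-- The even–odd separation permutation of `Fin (2h)`: position `k` is sent to `2k` for
`k < h`, and position `h + k` is sent to `2k + 1`; on vectors, `(P x)_k = x_{2k}` and
`(P x)_{h+k} = x_{2k+1}`. -/
def evenOddSep (h : ℕ) : Fin (2 * h) → Fin (2 * h) := fun k =>
  if hk : (k : ℕ) < h then ⟨2 * (k : ℕ), by omega⟩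
  else ⟨2 * ((k : ℕ) - h) + 1, by have := k.isLt; omega⟩

/-- Apply a permutation `π` of `Fin L` blockwise to `Fin (q·L)`: index `a·L + r` (`0 ≤ r < L`)
is sent to `a·L + π(r)`, using the standard (row-major) bijection `Fin q × Fin L ≃ Fin (q·L)`. -/
def blockwise (q L : ℕ) (π : Fin L → Fin L) : Fin (q * L) → Fin (q * L) := fun i =>
  finProdFinEquiv ((finProdFinEquiv.symm i).1, π (finProdFinEquiv.symm i).2)

/-- Stage `s` (for `1 ≤ s ≤ m`) of the recursive even–odd separation on `Fin (2^m)`: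
the even–odd separation permutation `P_{2^s}` acting independently on each of the `2^{m−s}`
consecutive blocks of length `2^s`. -/
def stage (m s : ℕ) (h1 : 1 ≤ s) (h2 : s ≤ m) : Fin (2 ^ m) → Fin (2 ^ m) := fun i =>
  finCongr (by rw [← pow_add]; congr 1; omega : 2 ^ (m - s) * 2 ^ s = 2 ^ m)
    (blockwise (2 ^ (m - s)) (2 ^ s)
      (fun r =>
        finCongr (by rw [← pow_succ' 2 (s - 1)]; congr 1; omega : 2 * 2 ^ (s - 1) = 2 ^ s)
          (evenOddSep (2 ^ (s - 1))
            (finCongr (by rw [← pow_succ' 2 (s - 1)]; congr 1; omega :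
                2 * 2 ^ (s - 1) = 2 ^ s).symm r)))
      (finCongr (by rw [← pow_add]; congr 1; omega : 2 ^ (m - s) * 2 ^ s = 2 ^ m).symm i))

/-- Peeling off the top bit: it becomes the lowest bit of the reversal. -/
lemma bitRev_succ_eq (s k : ℕ) : bitRev (s + 1) k = 2 * bitRev s k + k / 2 ^ s % 2 := by
  induction s generalizing k with
  | zero => simp [bitRev]
  | succ s ih =>
    rw [bitRev, ih, bitRev, Nat.div_div_eq_div_mul, ← pow_succ']
    ring

lemma val_evenOddSep (h : ℕ) (k : Fin (2 * h)) :
    (evenOddSep h k : ℕ) = 2 * (k % h) + k / h := by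
  have hk := k.isLt
  unfold evenOddSep
  split_ifs with hlt
  · simp [Nat.mod_eq_of_lt hlt, Nat.div_eq_of_lt hlt]
  · obtain ⟨d, hd⟩ := Nat.exists_eq_add_of_le (not_lt.mp hlt)
    have hdh : d < h := by omega
    simp [hd, Nat.mod_eq_of_lt hdh, Nat.div_eq_of_lt hdh, Nat.add_div_left d (by omega : 0 < h)]

/-- Stage `s + 1` rotates the `s + 1` lowest bits of an index to the left. -/
lemma val_stage (m s : ℕ) (h1 : 1 ≤ s + 1) (h2 : s + 1 ≤ m) (i : Fin (2 ^ m)) :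
    (stage m (s + 1) h1 h2 i : ℕ) =
      2 ^ (s + 1) * (i / 2 ^ (s + 1)) + (2 * (i % 2 ^ s) + i / 2 ^ s % 2) := by
  simp only [stage, blockwise, finProdFinEquiv, Equiv.coe_fn_mk, Equiv.coe_fn_symm_mk,
    finCongr_apply, Fin.val_cast, Fin.coe_divNat, Fin.coe_modNat, val_evenOddSep,
    Nat.add_sub_cancel, pow_succ, Nat.mod_mul_right_mod, Nat.mod_mul_right_div_self]
  ring

/-- One rotation extends the reversal of the lowest `s` bits to the lowest `s + 1` bits. -/
lemma val_stage_of_val_eq (m s : ℕ) (h1 : 1 ≤ s + 1) (h2 : s + 1 ≤ m) (i : ℕ) (w : Fin (2 ^ m))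
    (hw : (w : ℕ) = 2 ^ s * (i / 2 ^ s) + bitRev s i) :
    (stage m (s + 1) h1 h2 w : ℕ) = 2 ^ (s + 1) * (i / 2 ^ (s + 1)) + bitRev (s + 1) i := by
  have hlt := bitRev_lt s i
  have hdiv : (w : ℕ) / 2 ^ s = i / 2 ^ s := by
    rw [hw, Nat.mul_add_div (by positivity), Nat.div_eq_of_lt hlt, add_zero]
  have hmod : (w : ℕ) % 2 ^ s = bitRev s i := by
    rw [hw, Nat.mul_add_mod, Nat.mod_eq_of_lt hlt]
  rw [val_stage, bitRev_succ_eq, hmod, hdiv, pow_succ, ← Nat.div_div_eq_div_mul, hdiv,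
    Nat.div_div_eq_div_mul]

lemma foldr_comp_concat {β : Type*} (l : List (β → β)) (f : β → β) (y : β) :
    (l.concat f).foldr (· ∘ ·) id y = l.foldr (· ∘ ·) id (f y) := by
  induction l with
  | nil => rfl
  | cons g l ih => simpa using congrArg g (by simpa using ih)

/-- Stages `2, …, n + 1` together reverse the `n + 1` lowest bits of an index. -/
lemma foldr_stages_apply {α : Type*} (m n : ℕ) (hn : n + 1 ≤ m) (y : Fin (2 ^ m) → α)
    (i : Fin (2 ^ m)) : ∃ w : Fin (2 ^ m),
    (w : ℕ) = 2 ^ (n + 1) * (i / 2 ^ (n + 1)) + bitRev (n + 1) i ∧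
    (List.ofFn fun j : Fin n =>
        (fun y : Fin (2 ^ m) → α =>
          y ∘ stage m ((j : ℕ) + 2) (by omega) (by have := j.isLt; omega))).foldr
      (· ∘ ·) id y i = y w := by
  induction n generalizing y with
  | zero => exact ⟨i, by simp [bitRev, Nat.div_add_mod], by simp⟩
  | succ n ih =>
    obtain ⟨w, hw, h⟩ := ih (by omega) (y ∘ stage m (n + 2) (by omega) hn)
    refine ⟨_, val_stage_of_val_eq m (n + 1) (by omega) hn i w hw, ?_⟩
    rw [List.ofFn_succ', foldr_comp_concat]
    exact h

/-- **The composed even–odd separations give the bit-reversal permutation.**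
Each stage-`s` permutation acts on vectors by `(P x)_k = x_{σ_s(k)}` where `σ_s = stage m s`.
The composition `(blocks of P_4) ∘ ⋯ ∘ (blocks of P_{2^{m−1}}) ∘ P_{2^m}` — the stage at
scale `2^s` applied to the input first for `s = m`, then `s = m−1`, …, and last for `s = 2` —
equals the `m`-bit bit-reversal permutation of `Fin (2^m)`, which acts on vectors by
`(R x)_k = x_{bitRev(k)}`. -/
theorem evenOdd_stages_eq_bitRev (m : ℕ) (hm : 1 ≤ m) {α : Type*} (x : Fin (2 ^ m) → α) :
    (List.ofFn fun j : Fin (m - 1) =>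
        (fun y : Fin (2 ^ m) → α =>
          y ∘ stage m ((j : ℕ) + 2) (by omega) (by have := j.isLt; omega))).foldr
      (· ∘ ·) id x = x ∘ bitRevFun m := by
  funext i
  obtain ⟨w, hw, h⟩ := foldr_stages_apply m (m - 1) (by omega) x i
  rw [h, Function.comp_apply]
  congr 1
  ext
  rw [hw, Nat.sub_add_cancel hm, Nat.div_eq_of_lt i.isLt, mul_zero, zero_add, bitRevFun]
end

section
/- Let m ≥ 1, N = 2^m, and let t : ℤ → ℂ be any function defining the Toeplitz matrix T ∈ ℂ^{N×N} with T_{i,j} = t(i−j) for i, j ∈ Fin N. Then there exist butterfly matrices B₁, B₂ ∈ ℂ^{2N×2N} (each a product M_0 · M_1 ⋯ M_m of butterfly factors of size 2N = 2^{m+1}, where (M_k)_{i,j} = 0 whenever i ≠ j and the bitwise XOR of i and j is not equal to 2^{m−k}) and permutation matrices P₁, P₂ of size 2N such that for all i, j ∈ Fin N, T_{i,j} = (B₁ · P₁ · B₂ · P₂)_{ι(i), ι(j)}, where ι : Fin N → Fin 2N is the natural embedding. That is, every N×N Toeplitz matrix lies in the class (BP)²₂, being the upper-left N×N corner of a product of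 two BP matrices of size 2N. -/
/-- `M ∈ 𝔽^{2^m × 2^m}` is a *butterfly factor at level `k`* (`0 ≤ k < m`) if `M_{i,j} = 0`
whenever `i ≠ j` and the bitwise XOR of `i` and `j` is not `2^(m−1−k)`. -/
def IsButterflyFactor {𝔽 : Type*} [Zero 𝔽] (m k : ℕ)
    (M : Matrix (Fin (2 ^ m)) (Fin (2 ^ m)) 𝔽) : Prop :=
  ∀ i j : Fin (2 ^ m), i ≠ j → Nat.xor (i : ℕ) (j : ℕ) ≠ 2 ^ (m - 1 - k) → M i j = 0

/-- A *butterfly matrix* is a product `M_0 · M_1 ⋯ M_{m−1}` where each `M_k` is a butterfly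
factor at level `k`. -/
def IsButterflyMatrix {𝔽 : Type*} [Semiring 𝔽] (m : ℕ)
    (B : Matrix (Fin (2 ^ m)) (Fin (2 ^ m)) 𝔽) : Prop :=
  ∃ M : Fin m → Matrix (Fin (2 ^ m)) (Fin (2 ^ m)) 𝔽,
    (∀ k : Fin m, IsButterflyFactor m (k : ℕ) (M k)) ∧ B = (List.ofFn M).prod

/-- Appending a top bit to a number given by its bits. -/
theorem Nat.ofBits_castSucc_add {k : ℕ} (f : Fin (k + 1) → Bool) :
    Nat.ofBits f = Nat.ofBits (fun l : Fin k => f l.castSucc) + 2 ^ k * (f (Fin.last k)).toNat := by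
  induction k with
  | zero => simp [Nat.ofBits_succ]
  | succ k ih =>
    rw [Nat.ofBits_succ, ih, Nat.ofBits_succ]
    simp only [Function.comp_def, Fin.succ_castSucc, Fin.succ_last, Fin.castSucc_zero]
    ring

/-- Numbers whose `b` lowest bits agree are congruent modulo `2 ^ b`. -/
theorem Nat.modEq_two_pow_of_testBit {x y b : ℕ} (h : ∀ l < b, x.testBit l = y.testBit l) :
    x ≡ y [MOD 2 ^ b] := by
  refine Nat.eq_of_testBit_eq fun l => ?_
  simp only [Nat.testBit_mod_two_pow]
  by_cases hl : l < b <;> simp [hl, h]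

theorem Fin.ext_testBit {n : ℕ} {x y : Fin (2 ^ n)}
    (h : ∀ l < n, (x : ℕ).testBit l = (y : ℕ).testBit l) : x = y := by
  have := Nat.modEq_two_pow_of_testBit h
  rwa [Nat.ModEq, Nat.mod_eq_of_lt x.2, Nat.mod_eq_of_lt y.2, ← Fin.ext_iff] at this

/-- The number whose bits are the top `k` of the `n` bits of `j`, in reverse order. -/
def reverseTopBits (n k j : ℕ) : ℕ :=
  Nat.ofBits fun l : Fin k => j.testBit (n - 1 - l)

theorem reverseTopBits_succ (n k j : ℕ) :
    reverseTopBits n (k + 1) j =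
      reverseTopBits n k j + 2 ^ k * (j.testBit (n - 1 - k)).toNat := by
  simp [reverseTopBits, Nat.ofBits_castSucc_add]

/-- Bit reversal on `n`-bit numbers. -/
def bitReversal (n : ℕ) : Equiv.Perm (Fin (2 ^ n)) :=
  Function.Involutive.toPerm
    (fun j => ⟨reverseTopBits n n j, Nat.ofBits_lt_two_pow _⟩) fun j => by
      refine Fin.ext_testBit fun l hl => ?_
      have hl' : n - 1 - l < n := by omega
      simp only [reverseTopBits, Nat.testBit_ofBits_lt, hl, hl']
      congr 1
      omega

theorem bitReversal_symm (n : ℕ) : (bitReversal n).symm = bitReversal n := rfl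

theorem reverseTopBits_bitReversal (n : ℕ) (j : Fin (2 ^ n)) :
    reverseTopBits n n (bitReversal n j) = j :=
  congrArg Fin.val ((bitReversal n).symm_apply_apply j)

section FFT

variable {R : Type*} [CommRing R]

open Classical in
/-- The level-`k` factor of the decimation-in-time fast Fourier transform. -/
noncomputable def fftFactor (n : ℕ) (ω : R) (k : ℕ) : Matrix (Fin (2 ^ n)) (Fin (2 ^ n)) R :=
  fun x y =>
    if ∀ l, l ≠ n - 1 - k → (x : ℕ).testBit l = (y : ℕ).testBit l then
      ω ^ ((x : ℕ) * (2 ^ k * ((y : ℕ).testBit (n - 1 - k)).toNat))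
    else 0

theorem isButterflyFactor_fftFactor (n : ℕ) (ω : R) (k : ℕ) :
    IsButterflyFactor n k (fftFactor n ω k) := by
  intro x y hne hxor
  refine if_neg fun h => hxor ?_
  refine Nat.eq_of_testBit_eq fun l => ?_
  change ((x : ℕ) ^^^ (y : ℕ)).testBit l = _
  rw [Nat.testBit_xor, Nat.testBit_two_pow]
  by_cases hl : l = n - 1 - k
  · have : (x : ℕ).testBit l ≠ (y : ℕ).testBit l := fun hb => hne <| Fin.ext_testBit fun l' _ => by
      by_cases hl' : l' = n - 1 - k
      · rw [hl', ← hl, hb]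
      · exact h l' hl'
    simpa [hl] using this
  · simp [h l hl, Ne.symm hl]

open Classical in
/-- The product of the first `k` factors is supported on pairs of indices agreeing in their
`n - k` lowest bits, where it is the Fourier kernel of the `k` bits processed so far. -/
theorem prod_fftFactor_apply {n : ℕ} {ω : R} (hω : ω ^ 2 ^ n = 1) {k : ℕ} (hk : k ≤ n)
    (i j : Fin (2 ^ n)) :
    (List.ofFn fun l : Fin k => fftFactor n ω l).prod i j =
      if ∀ l < n - k, (i : ℕ).testBit l = (j : ℕ).testBit l then
        ω ^ ((i : ℕ) * reverseTopBits n k j) else 0 := by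
  induction k generalizing j with
  | zero =>
    simp only [List.ofFn_zero, List.prod_nil, Matrix.one_apply, reverseTopBits, Nat.ofBits_zero,
      mul_zero, pow_zero, Nat.sub_zero]
    exact if_congr ⟨fun h => by simp [h], Fin.ext_testBit⟩ rfl rfl
  | succ k ih =>
    obtain ⟨b, hb⟩ : ∃ b, n = k + b + 1 := ⟨n - k - 1, by omega⟩
    have hb1 : n - k = b + 1 := by omega
    have hb2 : n - (k + 1) = b := by omega
    have hb3 : n - 1 - k = b := by omega
    rw [List.ofFn_succ_last, List.prod_append, List.prod_singleton, Matrix.mul_apply]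
    simp only [Fin.val_castSucc, Fin.val_last, ih (by omega), fftFactor, hb1, hb2, hb3]
    let x₀ : Fin (2 ^ n) :=
      ⟨Nat.ofBits fun l : Fin n => if (l : ℕ) = b then (i : ℕ).testBit b else (j : ℕ).testBit l,
        Nat.ofBits_lt_two_pow _⟩
    have hx₀b : (x₀ : ℕ).testBit b = (i : ℕ).testBit b := by
      simp [x₀, show b < n by omega]
    have hx₀ : ∀ l, l ≠ b → (x₀ : ℕ).testBit l = (j : ℕ).testBit l := by
      intro l hl
      rcases lt_or_ge l n with hn | hn
      · simp [x₀, hl, hn]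
      · rw [Nat.testBit_lt_two_pow (x₀.2.trans_le (Nat.pow_le_pow_right two_pos hn)),
          Nat.testBit_lt_two_pow (j.2.trans_le (Nat.pow_le_pow_right two_pos hn))]
    rw [Finset.sum_eq_single x₀]
    · rw [if_pos hx₀]
      have hiff : (∀ l < b + 1, (i : ℕ).testBit l = (x₀ : ℕ).testBit l) ↔
          ∀ l < b, (i : ℕ).testBit l = (j : ℕ).testBit l := by
        constructor
        · intro h l hl
          rw [h l (by omega), hx₀ l (by omega)]
        · intro h l hl
          by_cases hlb : l = b
          · rw [hlb, hx₀b]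
          · rw [hx₀ l hlb, h l (by omega)]
      by_cases h : ∀ l < b, (i : ℕ).testBit l = (j : ℕ).testBit l
      · rw [if_pos (hiff.2 h), if_pos h, reverseTopBits_succ, hb3, mul_add, pow_add]
        have htop : reverseTopBits n k x₀ = reverseTopBits n k j := by
          refine congrArg Nat.ofBits (funext fun l => hx₀ _ ?_)
          have := l.2
          omega
        have hmod : (x₀ : ℕ) * 2 ^ k ≡ i * 2 ^ k [MOD 2 ^ n] := by
          have := (Nat.modEq_two_pow_of_testBit (hiff.2 h)).symm.mul_right' (2 ^ k)
          rwa [← pow_add, show b + 1 + k = n by omega] at this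
        rw [htop, ← mul_assoc, ← mul_assoc, pow_mul ω (_ * 2 ^ k), pow_mul ω (_ * 2 ^ k),
          pow_eq_pow_of_modEq hmod hω]
      · rw [if_neg (mt hiff.1 h), if_neg h, zero_mul]
    · intro x _ hx
      rw [ite_zero_mul_ite_zero, if_neg]
      rintro ⟨h₁, h₂⟩
      refine hx (Fin.ext_testBit fun l _ => ?_)
      by_cases hlb : l = b
      · rw [hlb, hx₀b, h₁ b (by omega)]
      · rw [hx₀ l hlb, h₂ l hlb]
    · simp

/-- The Fourier matrix of size `2 ^ n` with its columns in bit-reversed order. -/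
def bitReversedFourier (n : ℕ) (ω : R) : Matrix (Fin (2 ^ n)) (Fin (2 ^ n)) R :=
  fun i j => ω ^ ((i : ℕ) * reverseTopBits n n j)

theorem isButterflyMatrix_bitReversedFourier {n : ℕ} {ω : R} (hω : ω ^ 2 ^ n = 1) :
    IsButterflyMatrix n (bitReversedFourier n ω) := by
  refine ⟨fun k => fftFactor n ω k, fun k => isButterflyFactor_fftFactor n ω k, ?_⟩
  ext i j
  rw [prod_fftFactor_apply hω le_rfl, if_pos (by simp), bitReversedFourier]

theorem bitReversedFourier_mul_permMatrix (n : ℕ) (ω : R) :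
    bitReversedFourier n ω * (bitReversal n).permMatrix R =
      Matrix.of fun i j : Fin (2 ^ n) => ω ^ ((i : ℕ) * (j : ℕ)) := by
  ext i j
  rw [Equiv.Perm.permMatrix, PEquiv.mul_toMatrix_toPEquiv, Matrix.submatrix_apply,
    bitReversal_symm, bitReversedFourier, reverseTopBits_bitReversal, id, Matrix.of_apply]

theorem IsButterflyMatrix.diagonal_mul {n : ℕ}
    {B : Matrix (Fin (2 ^ (n + 1))) (Fin (2 ^ (n + 1))) R}
    (hB : IsButterflyMatrix (n + 1) B) (d : Fin (2 ^ (n + 1)) → R) :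
    IsButterflyMatrix (n + 1) (Matrix.diagonal d * B) := by
  obtain ⟨M, hM, rfl⟩ := hB
  refine ⟨Fin.cons (Matrix.diagonal d * M 0) fun k => M k.succ, fun k => ?_, ?_⟩
  · cases k using Fin.cases with
    | zero =>
      intro i j hne hxor
      rw [Fin.cons_zero, Matrix.diagonal_mul, hM 0 i j hne hxor, mul_zero]
    | succ k => exact hM k.succ
  · simp [List.ofFn_succ, mul_assoc]

end FFT

/-- Orthogonality of the powers of a primitive root of unity. -/
theorem IsPrimitiveRoot.sum_pow_mul_inv_pow {K : Type*} [Field K] {ζ : K} {N : ℕ}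
    (hζ : IsPrimitiveRoot ζ N) (hN : N ≠ 0) (a b : ℕ) :
    ∑ x : Fin N, ζ ^ (a * (x : ℕ)) * ζ⁻¹ ^ ((x : ℕ) * b) = if a ≡ b [MOD N] then (N : K) else 0 := by
  have hζ0 : ζ ≠ 0 := hζ.ne_zero hN
  have hterm : ∀ x : ℕ, ζ ^ (a * x) * ζ⁻¹ ^ (x * b) = (ζ ^ a / ζ ^ b) ^ x := fun x => by
    rw [mul_comm x b, pow_mul, pow_mul, inv_pow, ← mul_pow, div_eq_mul_inv]
  have hone : ζ ^ a / ζ ^ b = 1 ↔ a ≡ b [MOD N] := by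
    rw [div_eq_one_iff_eq (pow_ne_zero _ hζ0), hζ.eq_orderOf, ← Units.val_mk0 hζ0, orderOf_units,
      ← pow_eq_pow_iff_modEq, ← Units.val_inj, Units.val_pow_eq_pow_val, Units.val_pow_eq_pow_val]
  simp only [hterm, Fin.sum_univ_eq_sum_range fun x => (ζ ^ a / ζ ^ b) ^ x]
  split_ifs with h
  · simp [hone.2 h]
  · have hpow : (ζ ^ a / ζ ^ b) ^ N = 1 := by
      rw [div_pow, ← pow_mul, ← pow_mul, mul_comm a, mul_comm b, pow_mul, pow_mul, hζ.pow_eq_one]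
      simp
    rw [geom_sum_eq (mt hone.1 h), hpow, sub_self, zero_div]

/-- **Every Toeplitz matrix lies in the class (BP)²₂.**  For `N = 2^m` and any `t : ℤ → ℂ`,
the Toeplitz matrix `T_{i,j} = t(i−j)` is the upper-left `N×N` corner of a product
`B₁·P₁·B₂·P₂` of two BP matrices of size `2N = 2^{m+1}`: the `B`s are butterfly matrices
(products of `m+1` butterfly factors, the level-`k` factor supported where the XOR of the
indices is `2^{m−k}`), the `P`s are permutation matrices, and `ι : Fin N → Fin 2N` is the
natural embedding. -/
theorem toeplitz_mem_BPBP_corner (m : ℕ) (hm : 1 ≤ m) (t : ℤ → ℂ) :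
    ∃ (B₁ B₂ : Matrix (Fin (2 ^ (m + 1))) (Fin (2 ^ (m + 1))) ℂ)
      (σ₁ σ₂ : Equiv.Perm (Fin (2 ^ (m + 1)))),
      IsButterflyMatrix (m + 1) B₁ ∧ IsButterflyMatrix (m + 1) B₂ ∧
      ∀ i j : Fin (2 ^ m),
        t ((i : ℕ) - (j : ℕ) : ℤ) =
          (B₁ * σ₁.permMatrix ℂ * B₂ * σ₂.permMatrix ℂ)
            (Fin.castLE (Nat.pow_le_pow_right (by norm_num) (Nat.le_succ m)) i)
            (Fin.castLE (Nat.pow_le_pow_right (by norm_num) (Nat.le_succ m)) j) := by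
  set N := 2 ^ (m + 1) with hN
  have hN0 : N ≠ 0 := by positivity
  have hNm : N = 2 * 2 ^ m := by rw [hN]; ring
  obtain ⟨ζ, hζ⟩ : ∃ ζ : ℂ, IsPrimitiveRoot ζ N := ⟨_, Complex.isPrimitiveRoot_exp N hN0⟩
  -- First column of the circulant extension of the Toeplitz matrix.
  let c : Fin N → ℂ := fun s => if (s : ℕ) < 2 ^ m then t s else t (s - N)
  let d : Fin N → ℂ := fun x => (N : ℂ)⁻¹ * ∑ s : Fin N, c s * ζ⁻¹ ^ ((x : ℕ) * (s : ℕ))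
  refine ⟨bitReversedFourier (m + 1) ζ,
    Matrix.diagonal d * bitReversedFourier (m + 1) ζ⁻¹, bitReversal (m + 1), bitReversal (m + 1),
    isButterflyMatrix_bitReversedFourier hζ.pow_eq_one,
    (isButterflyMatrix_bitReversedFourier hζ.inv.pow_eq_one).diagonal_mul d, fun i j => ?_⟩
  have hi := i.2
  have hj := j.2
  rw [bitReversedFourier_mul_permMatrix, mul_assoc, mul_assoc, bitReversedFourier_mul_permMatrix,
    Matrix.mul_apply]
  simp only [Matrix.diagonal_mul, Matrix.of_apply, Fin.val_castLE]
  have hterm : ∀ x : Fin N, ζ ^ ((i : ℕ) * (x : ℕ)) * (d x * ζ⁻¹ ^ ((x : ℕ) * (j : ℕ))) =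
      ∑ s : Fin N, (N : ℂ)⁻¹ * c s *
        (ζ ^ ((i : ℕ) * (x : ℕ)) * ζ⁻¹ ^ ((x : ℕ) * ((j : ℕ) + s))) := fun x => by
    simp only [d, mul_add, pow_add, Finset.mul_sum, Finset.sum_mul]
    exact Finset.sum_congr rfl fun s _ => by ring
  obtain ⟨s₀, hs₀, hc⟩ : ∃ s₀ : Fin N, (∀ s : Fin N, (i : ℕ) ≡ j + s [MOD N] ↔ s = s₀) ∧
      c s₀ = t ((i : ℕ) - (j : ℕ) : ℤ) := by
    have huniq : ∀ s₀ : Fin N, (i : ℕ) ≡ j + s₀ [MOD N] →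
        ∀ s : Fin N, (i : ℕ) ≡ j + s [MOD N] ↔ s = s₀ := fun s₀ h s =>
      ⟨fun hs => Fin.ext <| Nat.ModEq.eq_of_lt_of_lt
        (Nat.ModEq.add_left_cancel' _ (hs.symm.trans h)) s.2 s₀.2, fun hs => hs ▸ h⟩
    rcases le_or_gt (j : ℕ) i with hji | hji
    · refine ⟨⟨i - j, by omega⟩, huniq _ ?_, ?_⟩
      · rw [Nat.add_sub_cancel' hji]
      · simp only [c]
        rw [if_pos (by omega), Nat.cast_sub hji]
    · refine ⟨⟨i + N - j, by omega⟩, huniq _ ?_, ?_⟩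
      · rw [Nat.add_sub_cancel' (by omega)]
        exact (Nat.add_modEq_right (a := i) (n := N)).symm
      · simp only [c]
        rw [if_neg (by omega), Nat.cast_sub (by omega)]
        congr 1
        push_cast
        ring
  calc t ((i : ℕ) - (j : ℕ) : ℤ)
      = ∑ s : Fin N, (N : ℂ)⁻¹ * c s * if s = s₀ then (N : ℂ) else 0 := by
        simp only [mul_ite, mul_zero, Finset.sum_ite_eq', Finset.mem_univ, if_true, hc]
        field_simp
    _ = ∑ s : Fin N, ∑ x : Fin N, (N : ℂ)⁻¹ * c s *
          (ζ ^ ((i : ℕ) * (x : ℕ)) * ζ⁻¹ ^ ((x : ℕ) * ((j : ℕ) + s))) := by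
        refine Finset.sum_congr rfl fun s _ => ?_
        rw [← Finset.mul_sum, hζ.sum_pow_mul_inv_pow hN0]
        simp only [hs₀]
    _ = _ := Finset.sum_comm.trans (Finset.sum_congr rfl fun x _ => (hterm x).symm)
end
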